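/- arXiv:1508.01189 — 3 statements merged into one kernel-verified Lean document; each statement's English description precedes it below -/
import Mathlib

section
/- For every integer N ≥ 3, det(L_N with row 1 and column 1 removed) + Σ_{i=1}^{N} det(L_N with row N+i and column N+i removed) = 2·((3 + √5)/2)^N + 2·((3 − √5)/2)^N − 4; that is, the normalisation factor Z equals 2((3+√5)/2)^N + 2((3−√5)/2)^N − 4. -/
open Matrix Real Filter

def Cmat (N : ℕ) : Matrix (Fin N) (Fin N) ℝ :=
  Matrix.of fun i j =>
    if i = j then 3
    else if ((i : ℕ) : ZMod N) - ((j : ℕ) : ZMod N) = 1 ∨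
        ((i : ℕ) : ZMod N) - ((j : ℕ) : ZMod N) = -1 then -1
    else 0

def Amat (N : ℕ) : Matrix (Fin N) (Fin N) ℝ :=
  Matrix.of fun i j =>
    if i = j then 1
    else if (i : ℕ) = (j : ℕ) + 1 ∧ (i : ℕ) + 1 < N then -1
    else if (i : ℕ) = N - 1 ∧ (j : ℕ) = 0 then -1
    else 0

def Bblk (N : ℕ) : Matrix (Fin N) (Fin N) ℝ :=
  Matrix.of fun i j => if (i : ℕ) = 0 ∧ (j : ℕ) = 0 then -1 else 0

def Lmat (N : ℕ) : Matrix (Fin (N + N)) (Fin (N + N)) ℝ :=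
  (Matrix.fromBlocks (Amat N) (Bblk N) (-1) (Cmat N)).submatrix
    finSumFinEquiv.symm finSumFinEquiv.symm

def dropIdx {n : ℕ} (i : Fin n) (k : Fin (n - 1)) : Fin n :=
  ⟨if (k : ℕ) < (i : ℕ) then (k : ℕ) else (k : ℕ) + 1, by
    have hk := k.isLt; have hi := i.isLt; split <;> omega⟩

def minor {n : ℕ} (M : Matrix (Fin n) (Fin n) ℝ) (i j : Fin n) :
    Matrix (Fin (n - 1)) (Fin (n - 1)) ℝ :=
  M.submatrix (dropIdx i) (dropIdx j)

/-- cyclic shift -/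
def Pm (m : ℕ) : Matrix (Fin (m+1)) (Fin (m+1)) ℝ :=
  Matrix.of fun i j => if i = j + 1 then 1 else 0

lemma Pm_mul_transpose (m : ℕ) : Pm m * (Pm m)ᵀ = 1 := by
  ext i k
  simp only [Matrix.mul_apply, Pm, Matrix.transpose_apply, Matrix.of_apply, Matrix.one_apply]
  rw [Finset.sum_eq_single (i - 1)]
  · simp [eq_comm]
  · intro b _ hb
    have : i ≠ b + 1 := by
      rintro rfl
      simp at hb
    simp [this]
  · simp

lemma Pm_row (m : ℕ) (i : Fin (m+1)) : ∑ j, Pm m i j = 1 := by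
  rw [Finset.sum_eq_single (i - 1)]
  · simp [Pm]
  · intro b _ hb
    have : i ≠ b + 1 := by
      rintro rfl
      simp at hb
    simp [Pm, this]
  · simp

lemma Pm_col (m : ℕ) (j : Fin (m+1)) : ∑ i, Pm m i j = 1 := by
  simp [Pm]

lemma Cmat_eq (m : ℕ) (hm : 2 ≤ m) :
    Cmat (m+1) = (3 : ℝ) • (1 : Matrix _ _ ℝ) - Pm m - (Pm m)ᵀ := by
  have hc : ∀ i : Fin (m+1), (((i : ℕ) : ZMod (m+1))) = (i : Fin (m+1)) := by
    intro i
    exact Fin.cast_val_eq_self i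
  have h10 : (1 : Fin (m+1)) ≠ 0 := by
    intro h
    have := congrArg Fin.val h
    rw [Fin.val_one', Nat.mod_eq_of_lt (by omega)] at this
    simp at this
  have h20 : (1 : Fin (m+1)) + 1 ≠ 0 := by
    intro h
    have := congrArg Fin.val h
    rw [Fin.val_add, Fin.val_one', Nat.mod_eq_of_lt (a := 1) (by omega),
      Nat.mod_eq_of_lt (by omega)] at this
    simp at this
  ext i j
  have e1 : (((i : ℕ) : ZMod (m+1)) - ((j : ℕ) : ZMod (m+1)) = 1) ↔ i = j + 1 := by
    have h : (i - j = 1) ↔ i = j + 1 := by rw [sub_eq_iff_eq_add, add_comm (1 : Fin (m+1)) j]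
    rw [hc i, hc j]
    exact h
  have e2 : (((i : ℕ) : ZMod (m+1)) - ((j : ℕ) : ZMod (m+1)) = -1) ↔ j = i + 1 := by
    have h : (i - j = -1) ↔ j = i + 1 := by
      rw [← neg_sub, neg_inj, sub_eq_iff_eq_add, add_comm (1 : Fin (m+1)) i]
    rw [hc i, hc j]
    exact h
  simp only [Cmat, Matrix.of_apply, e1, e2, Pm, Matrix.sub_apply, Matrix.smul_apply,
    Matrix.one_apply, Matrix.transpose_apply]
  by_cases h : i = j
  · subst h
    simp [h10]
  · by_cases h1 : i = j + 1
    · have : j ≠ i + 1 := by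
        intro h2
        rw [h1, add_assoc] at h2
        exact h20 (by simpa using h2)
      subst h1
      simp [this, h10]
    · by_cases h2 : j = i + 1
      · rw [if_neg h, if_pos (Or.inr h2), if_neg h, if_neg h1, if_pos h2]
        simp
      · rw [if_neg h, if_neg (by tauto), if_neg h, if_neg h1, if_neg h2]
        simp

lemma det_shift (m : ℕ) (hm : 1 ≤ m) (a : ℝ) :
    (a • (1 : Matrix _ _ ℝ) - Pm m).det = a ^ (m+1) - 1 := by
  obtain ⟨k, rfl⟩ : ∃ k, m = k + 1 := ⟨m - 1, by omega⟩
  have hne : (0 : Fin (k+1+1)) ≠ Fin.last (k+1) := by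
    intro h; simpa using congrArg Fin.val h
  have hval : ∀ i j : Fin (k+1+1), i = j + 1 ↔
      ((i : ℕ) = j + 1 ∨ (i : ℕ) = 0 ∧ (j : ℕ) = k + 1) := by
    intro i j
    rw [Fin.ext_iff, Fin.val_add_one]
    have := i.isLt
    split_ifs with h
    · subst h; simp; omega
    · have : (j : ℕ) ≠ k + 1 := fun h' => h (Fin.ext h')
      omega
  rw [Matrix.det_succ_row_zero, Finset.sum_eq_add_of_mem 0 (Fin.last (k+1)) (Finset.mem_univ _)
    (Finset.mem_univ _) hne]
  · have d1 : ((a • (1 : Matrix _ _ ℝ) - Pm (k+1)).submatrix Fin.succ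
        (Fin.succAbove 0)).det = a ^ (k+1) := by
      rw [Matrix.det_of_isLowerTriangular]
      · simp [Pm, hval]
      · intro i j hij
        have hij' : (i : ℕ) < j := hij
        have : i ≠ j := by rintro rfl; omega
        simp [Pm, hval, Matrix.one_apply, this]
        omega
    have d2 : ((a • (1 : Matrix _ _ ℝ) - Pm (k+1)).submatrix Fin.succ
        (Fin.succAbove (Fin.last (k+1)))).det = (-1) ^ (k+1) := by
      rw [Matrix.det_of_isUpperTriangular]
      · have : ∀ i : Fin (k+1), i.succ ≠ i.castSucc := by
          intro i h
          simpa using congrArg Fin.val h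
        simp [Pm, hval, Matrix.one_apply, this]
      · intro i j hij
        have hij' : (j : ℕ) < i := hij
        have : i.succ ≠ j.castSucc := by
          intro h
          have := congrArg Fin.val h
          simp at this; omega
        simp [Pm, hval, Matrix.one_apply, this]
        omega
    rw [d1, d2]
    simp [Pm, hval, Matrix.one_apply, hne]
    rw [← mul_pow]
    simp
    ring
  · rintro c - ⟨h0, h1⟩
    have h0' : (c : ℕ) ≠ 0 := fun h => h0 (Fin.ext h)
    have h1' : (c : ℕ) ≠ k + 1 := fun h => h1 (Fin.ext h)
    simp [Pm, hval, Matrix.one_apply, h0.symm, h1']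

lemma det_Cmat (m : ℕ) (hm : 2 ≤ m) :
    (Cmat (m+1)).det = ((3 + Real.sqrt 5) / 2) ^ (m+1) + ((3 - Real.sqrt 5) / 2) ^ (m+1) - 2 := by
  set a := (3 + Real.sqrt 5) / 2 with ha
  set b := (3 - Real.sqrt 5) / 2 with hb
  have h5 : Real.sqrt 5 * Real.sqrt 5 = 5 := Real.mul_self_sqrt (by norm_num)
  have hab : a * b = 1 := by rw [ha, hb]; linarith
  have hs : a + b = 3 := by rw [ha, hb]; ring
  have hC : Cmat (m+1) = b • ((a • (1 : Matrix _ _ ℝ) - Pm m) *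
      (a • (1 : Matrix _ _ ℝ) - Pm m)ᵀ) := by
    rw [Cmat_eq m hm, Matrix.transpose_sub, Matrix.transpose_smul, Matrix.transpose_one,
      sub_mul, mul_sub, mul_sub, Pm_mul_transpose]
    simp only [smul_mul_assoc, mul_smul_comm, mul_one, one_mul, smul_sub, smul_smul]
    rw [mul_comm b a, hab, mul_comm, mul_assoc, hab, ← hs]
    module
  rw [hC, Matrix.det_smul, Matrix.det_mul, Matrix.det_transpose, det_shift m (by omega)]
  have : a ^ (m+1) * b ^ (m+1) = 1 := by rw [← mul_pow, hab, one_pow]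
  simp only [Fintype.card_fin]
  linear_combination (a ^ (m+1) - 2) * this

lemma Cmat_row (m : ℕ) (hm : 2 ≤ m) (i : Fin (m+1)) : ∑ j, Cmat (m+1) i j = 1 := by
  rw [Cmat_eq m hm]
  simp [Finset.sum_sub_distrib, Pm_row, Pm_col, Matrix.one_apply]
  norm_num

lemma Cmat_col (m : ℕ) (hm : 2 ≤ m) (j : Fin (m+1)) : ∑ i, Cmat (m+1) i j = 1 := by
  rw [Cmat_eq m hm]
  simp [Finset.sum_sub_distrib, Pm_row, Pm_col, Matrix.one_apply]
  norm_num

lemma det_Cmat_ne (m : ℕ) (hm : 2 ≤ m) : (Cmat (m+1)).det ≠ 0 := by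
  rw [det_Cmat m hm]
  have h5 : Real.sqrt 5 * Real.sqrt 5 = 5 := Real.mul_self_sqrt (by norm_num)
  have hlt : 2 < Real.sqrt 5 := by
    rw [Real.lt_sqrt] <;> norm_num
  have hlt3 : Real.sqrt 5 < 3 := by
    rw [Real.sqrt_lt'] <;> norm_num
  have h1 : (2 : ℝ) < ((3 + Real.sqrt 5) / 2) ^ (m+1) :=
    calc (2 : ℝ) < ((3 + Real.sqrt 5) / 2) := by linarith
      _ ≤ _ := le_self_pow₀ (by linarith) (by omega)
  have h2 : 0 < ((3 - Real.sqrt 5) / 2) ^ (m+1) := pow_pos (by linarith) _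
  linarith

lemma det_Amat (m : ℕ) : (Amat (m+1)).det = 1 := by
  rw [Matrix.det_of_isLowerTriangular]
  · simp [Amat]
  · intro i j hij
    have hij' : (i : ℕ) < j := hij
    have : i ≠ j := by rintro rfl; omega
    simp only [Amat, Matrix.of_apply]
    rw [if_neg this, if_neg (by omega), if_neg (by omega)]

lemma Amat_row (m : ℕ) (hm : 2 ≤ m) (i : Fin (m+1)) :
    ∑ j, Amat (m+1) i j = if i = 0 then 1 else 0 := by
  by_cases h : i = 0
  · subst h
    rw [Finset.sum_eq_single 0]
    · simp [Amat]
    · intro b _ hb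
      have h0 : ((0 : Fin (m+1)) : ℕ) = 0 := rfl
      simp only [Amat, Matrix.of_apply]
      rw [if_neg hb.symm, if_neg (by omega), if_neg (by omega)]
    · simp
  · have h0 : (i : ℕ) ≠ 0 := fun h' => h (Fin.ext h')
    have hi := i.isLt
    rw [if_neg h]
    by_cases hl : (i : ℕ) = m
    · rw [Finset.sum_eq_add_of_mem i 0 (Finset.mem_univ _) (Finset.mem_univ _) h]
      · simp [Amat, h, hl]
      · rintro c - ⟨hc, hc0⟩
        have : (c : ℕ) ≠ 0 := fun h' => hc0 (Fin.ext h')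
        simp [Amat, hc.symm, hl, hc0]
    · have hne : i ≠ ⟨i - 1, by omega⟩ := by
        intro h'
        have := congrArg Fin.val h'
        simp at this; omega
      rw [Finset.sum_eq_add_of_mem i ⟨i - 1, by omega⟩ (Finset.mem_univ _) (Finset.mem_univ _) hne]
      · have e : (i : ℕ) = i - 1 + 1 ∧ (i : ℕ) < m := by omega
        simp [Amat, hne]
        rw [if_pos e]; simp
      · rintro c - ⟨hc, hc0⟩
        have : (c : ℕ) ≠ i - 1 := fun h' => hc0 (Fin.ext h')
        simp [Amat, hc.symm, hl]
        omega

/-- the Laplacian on the sum type -/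
def Ls (m : ℕ) : Matrix (Fin (m+1) ⊕ Fin (m+1)) (Fin (m+1) ⊕ Fin (m+1)) ℝ :=
  Matrix.fromBlocks (Amat (m+1)) (Bblk (m+1)) (-1) (Cmat (m+1))

/-- the Laplacian with the block `B` removed -/
def Ms (m : ℕ) : Matrix (Fin (m+1) ⊕ Fin (m+1)) (Fin (m+1) ⊕ Fin (m+1)) ℝ :=
  Matrix.fromBlocks (Amat (m+1)) 0 (-1) (Cmat (m+1))

lemma det_Ms (m : ℕ) : (Ms m).det = (Cmat (m+1)).det := by
  rw [Ms, Matrix.det_fromBlocks_zero₁₂, det_Amat, one_mul]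

lemma adj_inl (m : ℕ) : (Ls m).adjugate (Sum.inl 0) (Sum.inl 0) = (Cmat (m+1)).det := by
  rw [Matrix.adjugate_apply, ← det_Ms]
  congr 1
  ext i j
  by_cases hi : i = Sum.inl 0
  · subst hi
    rcases j with j | j
    · by_cases hj : j = 0
      · subst hj; simp [Ms, Amat]
      · have : (0 : Fin (m+1)) ≠ j := Ne.symm hj
        have h' : (j : ℕ) ≠ 0 := fun h' => hj (Fin.ext h')
        simp [Ms, Amat, this, hj]
    · simp [Ms]
  · rw [Matrix.updateRow_ne hi]
    rcases i with i | i <;> rcases j with j | j <;> simp [Ls, Ms, Bblk]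
    intro h
    exact absurd (congrArg Sum.inl h) hi

lemma Ms_one (m : ℕ) (hm : 2 ≤ m) : Ms m *ᵥ 1 = Pi.single (Sum.inl 0) 1 := by
  ext i
  rcases i with i | i
  · simp [Ms, Matrix.mulVec, dotProduct, Amat_row m hm, Pi.single_apply]
  · simp [Ms, Matrix.mulVec, dotProduct, Cmat_row m hm, Matrix.one_apply]

lemma Ls_mulVec (m : ℕ) (x : Fin (m+1) ⊕ Fin (m+1) → ℝ) :
    Ls m *ᵥ x = Ms m *ᵥ x - x (Sum.inr 0) • Pi.single (Sum.inl 0) 1 := by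
  ext i
  rcases i with i | i
  · by_cases h : i = 0
    · subst h
      simp [Ls, Ms, Matrix.mulVec, dotProduct, Bblk, sub_eq_add_neg]
    · simp [Ls, Ms, Matrix.mulVec, dotProduct, Bblk, h]
  · simp [Ls, Ms, Matrix.mulVec, dotProduct]

lemma Ls_ker (m : ℕ) (hm : 2 ≤ m) (x : Fin (m+1) ⊕ Fin (m+1) → ℝ) (hx : Ls m *ᵥ x = 0) :
    x = x (Sum.inr 0) • 1 := by
  have hinj := Matrix.mulVec_injective_of_isUnit (A := Ms m)
    ((Matrix.isUnit_iff_isUnit_det _).2 (by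
      rw [det_Ms]; exact isUnit_iff_ne_zero.2 (det_Cmat_ne m hm)))
  apply hinj
  rw [Ls_mulVec, sub_eq_zero] at hx
  rw [hx, Matrix.mulVec_smul, Ms_one m hm]

lemma Ls_det (m : ℕ) (hm : 2 ≤ m) : (Ls m).det = 0 := by
  apply Matrix.exists_mulVec_eq_zero_iff.1
  refine ⟨1, one_ne_zero, ?_⟩
  rw [Ls_mulVec, Ms_one m hm]
  simp

lemma adj_const (m : ℕ) (hm : 2 ≤ m) (i j k : Fin (m+1) ⊕ Fin (m+1)) :
    (Ls m).adjugate i k = (Ls m).adjugate j k := by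
  have h : Ls m *ᵥ (fun i => (Ls m).adjugate i k) = 0 := by
    ext i
    have := congrFun (congrFun (Matrix.mul_adjugate (Ls m)) i) k
    rw [Ls_det m hm] at this
    simpa [Matrix.mul_apply, Matrix.mulVec, dotProduct] using this
  have h' := Ls_ker m hm _ h
  have a1 := congrFun h' i
  have a2 := congrFun h' j
  simp only [Pi.smul_apply, Pi.one_apply] at a1 a2
  rw [a1, a2]

lemma adj_sum (m : ℕ) (hm : 2 ≤ m) :
    ∑ i, (Ls m).adjugate (Sum.inr i) (Sum.inr i) = (Cmat (m+1)).det := by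
  rw [← adj_inl m]
  set r : Fin (m+1) ⊕ Fin (m+1) → ℝ := fun k => (Ls m).adjugate (Sum.inl 0) k with hr
  have e : ∀ i, (Ls m).adjugate (Sum.inr i) (Sum.inr i) = r (Sum.inr i) :=
    fun i => adj_const m hm _ _ _
  have h : ∀ j : Fin (m+1), ∑ i, r (Sum.inl i) * Bblk (m+1) i j
      + ∑ i, r (Sum.inr i) * Cmat (m+1) i j = 0 := by
    intro j
    have := congrFun (congrFun (Matrix.adjugate_mul (Ls m)) (Sum.inl 0)) (Sum.inr j)
    rw [Ls_det m hm, Matrix.mul_apply, Fintype.sum_sum_type] at this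
    have e2 : (0 : ℝ) • (1 : Matrix (Fin (m+1) ⊕ Fin (m+1)) (Fin (m+1) ⊕ Fin (m+1)) ℝ) = 0 :=
      zero_smul _ _
    rw [e2] at this
    exact this
  have hs : ∑ j, (∑ i, r (Sum.inl i) * Bblk (m+1) i j
      + ∑ i, r (Sum.inr i) * Cmat (m+1) i j) = 0 := Finset.sum_eq_zero fun j _ => h j
  rw [Finset.sum_add_distrib, Finset.sum_comm, Finset.sum_comm (f := fun j i => r (Sum.inr i) * _)]
    at hs
  simp only [← Finset.mul_sum, Cmat_row m hm, mul_one] at hs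
  have hB : ∑ i, r (Sum.inl i) * ∑ j, Bblk (m+1) i j = - r (Sum.inl 0) := by
    rw [Finset.sum_eq_single 0]
    · simp [Bblk]
    · intro b _ hb
      simp [Bblk, hb]
    · simp
  rw [hB] at hs
  simp only [e]
  linarith

lemma minor_eq (n : ℕ) (M : Matrix (Fin (n+1)) (Fin (n+1)) ℝ) (i : Fin (n+1)) :
    (minor M i i).det = M.adjugate i i := by
  rw [Matrix.adjugate_fin_succ_eq_det_submatrix]
  have : (dropIdx i : Fin (n+1-1) → Fin (n+1)) = i.succAbove := by
    funext k
    apply Fin.ext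
    simp only [dropIdx, Fin.succAbove, Fin.lt_def, Fin.val_castSucc]
    split_ifs <;> simp_all
  rw [minor, this, Even.neg_one_pow ⟨_, rfl⟩, one_mul]

lemma minor_Lmat (m : ℕ) (i : Fin (m+1+(m+1))) :
    (minor (Lmat (m+1)) i i).det =
      (Ls m).adjugate (finSumFinEquiv.symm i) (finSumFinEquiv.symm i) := by
  have := minor_eq (m+1+m) (Lmat (m+1)) i
  refine this.trans ?_
  have h2 : (Lmat (m+1)) = (Ls m).submatrix finSumFinEquiv.symm finSumFinEquiv.symm := rfl
  have h3 := Matrix.adjugate_submatrix_equiv_self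
    (finSumFinEquiv (m := m+1) (n := m+1)).symm (Ls m)
  exact congrFun (congrFun h3 i) i

theorem stmt11 (N : ℕ) (hN : 3 ≤ N) :
    (minor (Lmat N) ⟨0, by omega⟩ ⟨0, by omega⟩).det +
      ∑ i : Fin N, (minor (Lmat N) (Fin.natAdd N i) (Fin.natAdd N i)).det =
    2 * ((3 + Real.sqrt 5) / 2) ^ N + 2 * ((3 - Real.sqrt 5) / 2) ^ N - 4 := by
  obtain ⟨m, rfl⟩ : ∃ m, N = m + 1 := ⟨N - 1, by omega⟩
  have hm : 2 ≤ m := by omega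
  have h0 : (finSumFinEquiv (m := m+1) (n := m+1)).symm ⟨0, by omega⟩ = Sum.inl 0 := by
    rw [Equiv.symm_apply_eq]
    apply Fin.ext
    simp
  simp only [minor_Lmat, h0, finSumFinEquiv_symm_apply_natAdd]
  rw [adj_inl, adj_sum m hm, det_Cmat m hm]
  ring
end

section
/- For every integer N ≥ 4, det(L_N with row N+2 and column N+2 removed) + det(L_N with row 2 and column 2 removed) − det(L_N with row N+1 and column N+1 removed) = det B_{N−1} − 2·det B_{N−2} − 2; that is, the numerator of the low-temperature ratchet current, det L_{(2,1)} + det L_{(2,0)} − det L_{(1,1)}, equals det B_{N−1} − 2 det B_{N−2} − 2. -/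
open Matrix Real Filter

def Bmat (N : ℕ) : Matrix (Fin N) (Fin N) ℝ :=
  Matrix.of fun i j =>
    if i = j then 3 else if (i : ℕ) = (j : ℕ) + 1 ∨ (j : ℕ) = (i : ℕ) + 1 then -1 else 0

lemma det_minor_eq {n : ℕ} (M : Matrix (Fin n) (Fin n) ℝ) (i : Fin n) :
    (minor M i i).det = M.adjugate i i := by
  cases n with
  | zero => exact i.elim0
  | succ n =>
    rw [adjugate_fin_succ_eq_det_submatrix]
    have h1 : ((-1 : ℝ)) ^ ((i : ℕ) + (i : ℕ)) = 1 := by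
      rw [← two_mul, pow_mul]; simp
    rw [h1, one_mul]
    have h2 : (dropIdx i : Fin (n + 1 - 1) → Fin (n + 1)) = i.succAbove := by
      funext k
      apply Fin.ext
      simp only [dropIdx, Fin.succAbove, Fin.lt_def, Fin.val_castSucc]
      split_ifs <;> simp
    unfold minor
    rw [h2]

lemma det_blocks_of_mul {N : ℕ} (A B D C X : Matrix (Fin N) (Fin N) ℝ) (h : A * X = B) :
    (fromBlocks A B D C).det = A.det * (C - D * X).det := by
  have : fromBlocks A B D C = fromBlocks A 0 D (C - D * X) * fromBlocks 1 X 0 1 := by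
    rw [fromBlocks_multiply]; simp [h]
  rw [this, det_mul, det_fromBlocks_zero₁₂, det_fromBlocks_zero₂₁]; simp

lemma adj_inr {N : ℕ} (A B D C X : Matrix (Fin N) (Fin N) ℝ) (h : A * X = B) (j : Fin N) :
    (fromBlocks A B D C).adjugate (Sum.inr j) (Sum.inr j) =
      A.det * (C - D * X).adjugate j j := by
  rw [adjugate_apply, adjugate_apply]
  have : (fromBlocks A B D C).updateRow (Sum.inr j) (Pi.single (Sum.inr j) 1) =
      fromBlocks A B (D.updateRow j 0) (C.updateRow j (Pi.single j 1)) := by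
    ext a b
    rcases a with a | a <;> rcases b with b | b <;>
      simp [updateRow_apply, Pi.single_apply]
  rw [this, det_blocks_of_mul _ _ _ _ X h]
  congr 2
  ext a b
  by_cases hab : a = j
  · subst hab; simp [Matrix.mul_apply]
  · simp [updateRow_apply, Matrix.mul_apply, hab]

lemma adj_inl_s12 {N : ℕ} (A B D C X : Matrix (Fin N) (Fin N) ℝ) (j : Fin N)
    (h : A.updateRow j (Pi.single j 1) * X = B.updateRow j 0) :
    (fromBlocks A B D C).adjugate (Sum.inl j) (Sum.inl j) =
      (A.updateRow j (Pi.single j 1)).det * (C - D * X).det := by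
  rw [adjugate_apply]
  have : (fromBlocks A B D C).updateRow (Sum.inl j) (Pi.single (Sum.inl j) 1) =
      fromBlocks (A.updateRow j (Pi.single j 1)) (B.updateRow j 0) D C := by
    ext a b
    rcases a with a | a <;> rcases b with b | b <;>
      simp [updateRow_apply, Pi.single_apply]
  rw [this, det_blocks_of_mul _ _ _ _ X h]

lemma Cmat_sub_eq {N : ℕ} (hN : 3 ≤ N) (i j : Fin N) :
    ((i : ℕ) : ZMod N) - ((j : ℕ) : ZMod N) = 1 ↔
      ((i : ℕ) = j + 1 ∨ ((i : ℕ) = 0 ∧ (j : ℕ) + 1 = N)) := by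
  have hi := i.isLt
  have hj := j.isLt
  rw [sub_eq_iff_eq_add']
  have : ((j : ℕ) : ZMod N) + 1 = (((j : ℕ) + 1 : ℕ) : ZMod N) := by push_cast; rfl
  rw [this, ZMod.natCast_eq_natCast_iff', Nat.mod_eq_of_lt hi]
  rcases Nat.lt_or_ge ((j : ℕ) + 1) N with h | h
  · rw [Nat.mod_eq_of_lt h]; omega
  · have : (j : ℕ) + 1 = N := by omega
    rw [this, Nat.mod_self]; omega

lemma Cmat_apply {N : ℕ} (hN : 3 ≤ N) (i j : Fin N) :
    Cmat N i j = if (i : ℕ) = j then 3 else if ((i : ℕ) = j + 1 ∨ (j : ℕ) = i + 1 ∨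
      ((i : ℕ) = 0 ∧ (j : ℕ) + 1 = N) ∨ ((j : ℕ) = 0 ∧ (i : ℕ) + 1 = N)) then -1 else 0 := by
  have h2 : ((i : ℕ) : ZMod N) - ((j : ℕ) : ZMod N) = -1 ↔
      ((j : ℕ) : ZMod N) - ((i : ℕ) : ZMod N) = 1 := by
    rw [← neg_sub, neg_inj]
  simp only [Cmat, of_apply, h2, Cmat_sub_eq hN, Fin.ext_iff]
  split_ifs <;> first | rfl | omega

lemma Bmat_apply {N : ℕ} (i j : Fin N) :
    Bmat N i j = if (i : ℕ) = j then 3 else if ((i : ℕ) = j + 1 ∨ (j : ℕ) = i + 1)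
      then -1 else 0 := by
  simp only [Bmat, of_apply, Fin.ext_iff]

lemma Bmat_det_ne (n : ℕ) : (Bmat n).det ≠ 0 := by
  apply det_ne_zero_of_sum_row_lt_diag
  intro k
  have h1 : ∀ j ∈ Finset.univ.erase k, ‖Bmat n k j‖ ≤
      (if (j : ℕ) = k + 1 then (1 : ℝ) else 0) + (if (k : ℕ) = j + 1 then (1 : ℝ) else 0) := by
    intro j hj
    have hjk : (k : ℕ) ≠ j := fun h => (Finset.ne_of_mem_erase hj) (Fin.ext h.symm)
    rw [Bmat_apply, if_neg hjk]
    split_ifs <;> first | omega | norm_num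
  have h2 : ∀ p : Fin n → Prop, ∀ [DecidablePred p], (∀ a b, p a → p b → a = b) →
      ∑ j ∈ Finset.univ.erase k, (if p j then (1 : ℝ) else 0) ≤ 1 := by
    intro p _ hp
    rw [Finset.sum_boole]
    have : (Finset.filter p (Finset.univ.erase k)).card ≤ 1 := by
      rw [Finset.card_le_one]
      intro a ha b hb
      exact hp a b (Finset.mem_filter.1 ha).2 (Finset.mem_filter.1 hb).2
    exact_mod_cast this
  have h3 : ‖Bmat n k k‖ = 3 := by rw [Bmat_apply]; simp
  rw [h3]
  calc _ ≤ _ := Finset.sum_le_sum h1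
    _ ≤ 1 + 1 := by
      rw [Finset.sum_add_distrib]
      apply add_le_add
      · exact h2 _ (fun a b ha hb => Fin.ext (by omega))
      · exact h2 _ (fun a b ha hb => Fin.ext (by omega))
    _ < 3 := by norm_num

lemma adjB_zz (m : ℕ) : (Bmat (m + 1)).adjugate 0 0 = (Bmat m).det := by
  rw [adjugate_fin_succ_eq_det_submatrix]
  simp only [Fin.val_zero, add_zero, pow_zero, one_mul]
  congr 1
  ext i j
  simp [Bmat_apply]

lemma adjB_ll (m : ℕ) : (Bmat (m + 1)).adjugate (Fin.last m) (Fin.last m) = (Bmat m).det := by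
  rw [adjugate_fin_succ_eq_det_submatrix]
  have h1 : ((-1 : ℝ)) ^ (((Fin.last m : Fin (m + 1)) : ℕ) + ((Fin.last m : Fin (m + 1)) : ℕ)) = 1 := by
    rw [← two_mul, pow_mul]; simp
  rw [h1, one_mul]
  congr 1
  ext i j
  simp [Bmat_apply]

lemma adjB_lz (m : ℕ) : (Bmat (m + 1)).adjugate (Fin.last m) 0 = 1 := by
  rw [adjugate_fin_succ_eq_det_submatrix]
  rw [det_of_isUpperTriangular]
  · have : ∀ i : Fin m, (Bmat (m + 1)).submatrix (Fin.succAbove 0) (Fin.last m).succAbove i i = -1 := by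
      intro i
      simp [Bmat_apply]
    rw [Finset.prod_congr rfl (fun i _ => this i)]
    simp [← mul_pow]
  · intro i j hij
    have : (j : ℕ) < i := hij
    simp only [submatrix_apply, Bmat_apply, Fin.succAbove_zero, Fin.succAbove_last, Fin.val_succ,
      Fin.val_castSucc]
    split_ifs <;> first | rfl | omega

lemma Bmat_transpose (m : ℕ) : (Bmat m)ᵀ = Bmat m := by
  ext i j
  simp only [transpose_apply, Bmat_apply]
  split_ifs <;> first | rfl | omega

lemma adjB_zl (m : ℕ) : (Bmat (m + 1)).adjugate 0 (Fin.last m) = 1 := by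
  rw [← adjB_lz m]
  conv_rhs => rw [← Bmat_transpose, ← adjugate_transpose]
  rfl

/-- bordered determinant -/
lemma det_border {n : ℕ} (M : Matrix (Fin (n + 1)) (Fin (n + 1)) ℝ) (B : Matrix (Fin n) (Fin n) ℝ)
    (hB : M.submatrix Fin.succ Fin.succ = B) (hd : B.det ≠ 0) :
    M.det = M 0 0 * B.det -
      (fun j : Fin n => M 0 j.succ) ⬝ᵥ (B.adjugate *ᵥ (fun i : Fin n => M i.succ 0)) := by
  set s : Fin n → ℝ := fun i => M i.succ 0 with hs
  set r : Fin n → ℝ := fun j => M 0 j.succ with hr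
  set v : Fin (n + 1) → ℝ := Fin.cons B.det (-(B.adjugate *ᵥ s)) with hv
  have key : M *ᵥ v = Pi.single 0 (M 0 0 * B.det - r ⬝ᵥ (B.adjugate *ᵥ s)) := by
    funext i
    refine Fin.cases ?_ (fun i => ?_) i
    · simp [mulVec, dotProduct, Fin.sum_univ_succ, hv, hr, sub_eq_add_neg]
    · have h1 : B *ᵥ (B.adjugate *ᵥ s) = B.det • s := by
        rw [mulVec_mulVec, mul_adjugate, smul_mulVec, one_mulVec]
      have h2 := congrFun h1 i
      simp only [mulVec, dotProduct, Pi.smul_apply, smul_eq_mul] at h2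
      simp only [mulVec, dotProduct, Fin.sum_univ_succ, hv, Fin.cons_zero, Fin.cons_succ,
        Pi.neg_apply, Pi.single_apply]
      simp only [mul_neg, Finset.sum_neg_distrib]
      have h3 : ∀ j, M i.succ j.succ = B i j := fun j => by rw [← hB]; rfl
      simp only [h3, h2]
      simp [hs]
      ring
  have h4 : M.adjugate *ᵥ (M *ᵥ v) = M.det • v := by
    rw [mulVec_mulVec, adjugate_mul, smul_mulVec, one_mulVec]
  have h5 := congrFun h4 0
  have h6 : M.adjugate 0 0 = B.det := by
    rw [adjugate_fin_succ_eq_det_submatrix, ← hB]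
    simp
  rw [key] at h5
  simp [h6, hv] at h5
  apply mul_right_cancel₀ hd
  linarith

lemma T1aux (m : ℕ) (K : Matrix (Fin (m + 2)) (Fin (m + 2)) ℝ)
    (hK : ∀ i j, K i j = Bmat (m + 2) i j - if j = Fin.last (m + 1) then 1 else 0) :
    K.det = 1 + (Bmat (m + 1)).det := by
  have h1 : K = (Bmat (m + 2)).updateCol (Fin.last (m + 1))
      (fun i => Bmat (m + 2) i (Fin.last (m + 1)) - 1) := by
    ext i j
    rw [hK, updateCol_apply]
    split_ifs with h
    · rw [h]
    · simp
  have hone : ∀ i : Fin (m + 2), ∑ j, Bmat (m + 2) i j =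
      1 + (if i = 0 then 1 else 0) + (if i = Fin.last (m + 1) then 1 else 0) := by
    intro i
    have h : ∀ j, Bmat (m + 2) i j = (if j = i then 3 else 0) -
        (if (j : ℕ) = i + 1 then 1 else 0) - (if (j : ℕ) + 1 = i then 1 else 0) := by
      intro j
      rw [Bmat_apply]
      simp only [Fin.ext_iff]
      split_ifs <;> first | omega | norm_num
    simp only [h, Finset.sum_sub_distrib]
    have e1 : ∑ j : Fin (m + 2), (if (j : ℕ) = i + 1 then (1 : ℝ) else 0) =
        if i = Fin.last (m + 1) then 0 else 1 := by
      split_ifs with hi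
      · apply Finset.sum_eq_zero
        intro j _
        rw [if_neg]
        have := j.isLt
        rw [hi]; simp; omega
      · have hlt : (i : ℕ) + 1 < m + 2 := by
          have := i.isLt
          have h' : (i : ℕ) ≠ m + 1 := fun h' => hi (Fin.ext h')
          omega
        rw [Finset.sum_eq_single (⟨i + 1, hlt⟩ : Fin (m + 2))]
        · simp
        · intro b _ hb
          rw [if_neg]
          intro h'; exact hb (Fin.ext h')
        · simp
    have e2 : ∑ j : Fin (m + 2), (if (j : ℕ) + 1 = i then (1 : ℝ) else 0) =
        if i = 0 then 0 else 1 := by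
      split_ifs with hi
      · apply Finset.sum_eq_zero
        intro j _
        rw [if_neg]
        rw [hi]; simp
      · have hlt : (i : ℕ) ≠ 0 := fun h' => hi (Fin.ext h')
        have := i.isLt
        rw [Finset.sum_eq_single (⟨i - 1, by omega⟩ : Fin (m + 2))]
        · rw [if_pos]; simp; omega
        · intro b _ hb
          rw [if_neg]
          intro h'; exact hb (Fin.ext (by simp; omega))
        · simp
    rw [e1, e2]
    simp only [Finset.sum_ite_eq', Finset.mem_univ, if_true]
    split_ifs <;> norm_num
  have h2 : (fun i => Bmat (m + 2) i (Fin.last (m + 1)) - 1) =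
      Bmat (m + 2) *ᵥ (Pi.single (Fin.last (m + 1)) 1 - 1) +
        (Pi.single 0 1 + Pi.single (Fin.last (m + 1)) 1) := by
    funext i
    have := hone i
    have h1' : (Bmat (m + 2) *ᵥ 1) i = ∑ j, Bmat (m + 2) i j := by simp [mulVec, dotProduct]
    simp only [mulVec_sub, Pi.add_apply, Pi.sub_apply, mulVec_single_one, h1', col_apply,
      Pi.single_apply, this]
    ring
  rw [h1, ← cramer_apply, cramer_eq_adjugate_mulVec, h2, mulVec_add, mulVec_mulVec, adjugate_mul,
    mulVec_add, smul_mulVec, one_mulVec]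
  simp [adjB_ll, adjB_lz]

lemma Amat_det {N : ℕ} (hN : 2 ≤ N) : (Amat N).det = 1 := by
  rw [det_of_isLowerTriangular]
  · simp [Amat]
  · intro i j hij
    have : (i : ℕ) < j := hij
    simp only [Amat, of_apply, Fin.ext_iff]
    split_ifs <;> first | rfl | omega

lemma Amat_det' {N : ℕ} (hN : 2 ≤ N) (k : Fin N) :
    ((Amat N).updateRow k (Pi.single k 1)).det = 1 := by
  rw [det_of_isLowerTriangular]
  · apply Finset.prod_eq_one
    intro i _
    by_cases h : i = k
    · subst h; simp
    · simp [updateRow_apply, h, Amat]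
  · intro i j hij
    have : (i : ℕ) < j := hij
    simp only [Amat, of_apply, updateRow_apply, Pi.single_apply, Fin.ext_iff]
    split_ifs <;> first | rfl | omega

def pIdx {m : ℕ} (i : Fin (m + 3)) : Fin (m + 3) :=
  ⟨if (i : ℕ) = m + 2 then 0 else (i : ℕ) - 1, by have := i.isLt; split_ifs <;> omega⟩

lemma Amat_mulVec {m : ℕ} (x : Fin (m + 3) → ℝ) (i : Fin (m + 3)) :
    (Amat (m + 3) *ᵥ x) i = x i - if (i : ℕ) = 0 then 0 else x (pIdx i) := by
  have h : ∀ k, Amat (m + 3) i k * x k = (if k = i then x k else 0) -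
      (if k = pIdx i then (if (i : ℕ) = 0 then 0 else x k) else 0) := by
    intro k
    have := i.isLt
    have := k.isLt
    simp only [Amat, of_apply, pIdx, Fin.ext_iff]
    split_ifs <;> first | omega | (simp; done) | (exfalso; simp_all; done) | (exfalso; simp_all; omega) | grind
  simp only [mulVec, dotProduct, h, Finset.sum_sub_distrib]
  simp

def X1 (m : ℕ) : Matrix (Fin (m + 3)) (Fin (m + 3)) ℝ :=
  of fun _ j => if (j : ℕ) = 0 then -1 else 0

def X2 (m : ℕ) : Matrix (Fin (m + 3)) (Fin (m + 3)) ℝ :=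
  of fun i j => if (j : ℕ) = 0 ∧ ((i : ℕ) = 0 ∨ (i : ℕ) = m + 2) then -1 else 0

lemma mul_X1 (m : ℕ) : Amat (m + 3) * X1 m = Bblk (m + 3) := by
  ext i j
  have := Amat_mulVec (fun k => X1 m k j) i
  simp only [mul_apply]
  simp only [mulVec, dotProduct] at this
  rw [this]
  simp only [X1, Bblk, of_apply]
  split_ifs <;> first | omega | (simp; done) | (exfalso; simp_all; done) | (exfalso; simp_all; omega) | grind

lemma mul_X2 (m : ℕ) (k : Fin (m + 3)) (hk : (k : ℕ) = 1) :
    (Amat (m + 3)).updateRow k (Pi.single k 1) * X2 m = (Bblk (m + 3)).updateRow k 0 := by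
  ext i j
  by_cases hi : i = k
  · subst hi
    simp only [mul_apply, updateRow_self, Pi.zero_apply, Pi.single_apply, ite_mul, one_mul,
      zero_mul, Finset.sum_ite_eq', Finset.mem_univ, if_true, X2, of_apply]
    rw [if_neg]; omega
  · have := Amat_mulVec (fun k => X2 m k j) i
    simp only [mul_apply, updateRow_apply, if_neg hi]
    simp only [mulVec, dotProduct] at this
    rw [this]
    have hi' : (i : ℕ) ≠ 1 := fun h => hi (Fin.ext (by omega))
    have := i.isLt
    simp only [X2, Bblk, of_apply, pIdx]
    split_ifs <;> first | omega | (simp; done) | (exfalso; simp_all; done) | (exfalso; simp_all; omega) | grind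

lemma T3 (m : ℕ) : (Cmat (m + 3) + X1 m).adjugate 0 0 = (Bmat (m + 2)).det := by
  rw [adjugate_fin_succ_eq_det_submatrix]
  simp only [Fin.val_zero, add_zero, pow_zero, one_mul]
  congr 1
  ext i j
  simp only [submatrix_apply, Fin.succAbove_zero, Matrix.add_apply, Cmat_apply (by omega : 3 ≤ m + 3),
    X1, of_apply, Bmat_apply, Fin.val_succ]
  split_ifs <;> first | omega | (simp; done) | (exfalso; simp_all; done) | (exfalso; simp_all; omega) | grind

lemma T1 (m : ℕ) : (Cmat (m + 3) + X1 m).adjugate 1 1 = 1 + (Bmat (m + 1)).det := by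
  have h := adjugate_submatrix_equiv_self (finRotate (m + 3)) (Cmat (m + 3) + X1 m)
  have h0 := congrFun (congrFun h 0) 0
  rw [submatrix_apply, finRotate_apply_zero] at h0
  rw [← h0, adjugate_fin_succ_eq_det_submatrix]
  simp only [Fin.val_zero, add_zero, pow_zero, one_mul]
  apply T1aux
  intro i j
  have := i.isLt
  have := j.isLt
  simp only [submatrix_apply, Fin.succAbove_zero, Matrix.add_apply, Cmat_apply (by omega : 3 ≤ m + 3),
    X1, of_apply, Bmat_apply, coe_finRotate, Fin.ext_iff, Fin.val_succ, Fin.val_last]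
  split_ifs <;> first | omega | (norm_num; done) | (exfalso; simp_all; done) | (exfalso; simp_all; omega) | grind

lemma T2 (m : ℕ) : (Cmat (m + 3) + X2 m).det =
    2 * (Bmat (m + 2)).det - 3 * (Bmat (m + 1)).det - 3 := by
  rw [det_border _ (Bmat (m + 2)) _ (Bmat_det_ne _)]
  · have h1 : (fun j : Fin (m + 2) => (Cmat (m + 3) + X2 m) 0 j.succ) =
        -(Pi.single 0 1 + Pi.single (Fin.last (m + 1)) 1) := by
      funext j
      simp only [Matrix.add_apply, Cmat_apply (by omega : 3 ≤ m + 3), X2, of_apply, Pi.neg_apply,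
        Pi.add_apply, Pi.single_apply, Fin.ext_iff, Fin.val_succ, Fin.val_last, Fin.val_zero]
      split_ifs <;> first | omega | (norm_num; done) | (exfalso; simp_all; done) | (exfalso; simp_all; omega) | grind
    have h2 : (fun j : Fin (m + 2) => (Cmat (m + 3) + X2 m) j.succ 0) =
        -(Pi.single 0 1 + Pi.single (Fin.last (m + 1)) 2) := by
      funext j
      simp only [Matrix.add_apply, Cmat_apply (by omega : 3 ≤ m + 3), X2, of_apply, Pi.neg_apply,
        Pi.add_apply, Pi.single_apply, Fin.ext_iff, Fin.val_succ, Fin.val_last, Fin.val_zero]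
      split_ifs <;> first | omega | (norm_num; done) | (exfalso; simp_all; done) | (exfalso; simp_all; omega) | grind
    have h3 : (Cmat (m + 3) + X2 m) 0 0 = 2 := by
      simp only [Matrix.add_apply, Cmat_apply (by omega : 3 ≤ m + 3), X2, of_apply]
      norm_num
    rw [h1, h2, h3]
    simp [mulVec_neg, mulVec_add, adjB_zz, adjB_ll, adjB_lz, adjB_zl, add_dotProduct]
    ring
  · ext i j
    simp only [submatrix_apply, Matrix.add_apply, Cmat_apply (by omega : 3 ≤ m + 3),
      X2, of_apply, Bmat_apply, Fin.val_succ]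
    split_ifs <;> first | omega | (simp; done) | (exfalso; simp_all; done) | (exfalso; simp_all; omega) | grind

theorem stmt12 (N : ℕ) (hN : 4 ≤ N) :
    (minor (Lmat N) (Fin.natAdd N ⟨1, by omega⟩) (Fin.natAdd N ⟨1, by omega⟩)).det +
      (minor (Lmat N) ⟨1, by omega⟩ ⟨1, by omega⟩).det -
      (minor (Lmat N) (Fin.natAdd N ⟨0, by omega⟩) (Fin.natAdd N ⟨0, by omega⟩)).det =
    (Bmat (N - 1)).det - 2 * (Bmat (N - 2)).det - 2 := by
  obtain ⟨m, rfl⟩ : ∃ m, N = m + 3 := ⟨N - 3, by omega⟩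
  have hc : (⟨1, by omega⟩ : Fin (m + 3 + (m + 3))) = Fin.castAdd (m + 3) ⟨1, by omega⟩ := rfl
  have e1 : (Cmat (m + 3) - (-1) * X1 m) = Cmat (m + 3) + X1 m := by simp
  have e2 : (Cmat (m + 3) - (-1) * X2 m) = Cmat (m + 3) + X2 m := by simp
  rw [det_minor_eq, det_minor_eq, det_minor_eq, hc]
  unfold Lmat
  rw [adjugate_submatrix_equiv_self]
  simp only [submatrix_apply, finSumFinEquiv_symm_apply_natAdd,
    finSumFinEquiv_symm_apply_castAdd]
  rw [adj_inr _ _ _ _ _ (mul_X1 m), adj_inr _ _ _ _ _ (mul_X1 m),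
    adj_inl_s12 _ _ _ _ (X2 m) _ (mul_X2 m _ rfl), Amat_det (by omega), Amat_det' (by omega), e1, e2]
  have t1 : (Cmat (m + 3) + X1 m).adjugate ⟨1, by omega⟩ ⟨1, by omega⟩ =
    1 + (Bmat (m + 1)).det := T1 m
  have t3 : (Cmat (m + 3) + X1 m).adjugate ⟨0, by omega⟩ ⟨0, by omega⟩ =
    (Bmat (m + 2)).det := T3 m
  rw [t1, t3, T2]
  have e3 : m + 3 - 1 = m + 2 := rfl
  have e4 : m + 3 - 2 = m + 1 := rfl
  rw [e3, e4]
  ring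
end

section
/- As N → ∞, the low-temperature ratchet current J_R(N) := (det B_{N−1} − 2·det B_{N−2} − 2) / (2·det C_N) converges, and its limit equals 1/2 − 1/√5. -/
open Matrix Real Filter

lemma Bmat_rec (n : ℕ) : (Bmat (n+2)).det = 3 * (Bmat (n+1)).det - (Bmat n).det := by
  have h1 : (Bmat (n+2)).submatrix Fin.succ Fin.succ = Bmat (n+1) := by
    ext i j
    simp [Bmat]
  have h2 : ((Bmat (n+2)).submatrix Fin.succ (Fin.succAbove 1)).det = - (Bmat n).det := by
    have a0 : Fin.succAbove (1 : Fin (n+2)) 0 = 0 := rfl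
    have a1 : ∀ j : Fin n, Fin.succAbove (1 : Fin (n+2)) j.succ = j.succ.succ := fun j => by
      have : (1 : Fin (n+2)) = Fin.succ 0 := rfl
      rw [this, Fin.succ_succAbove_succ, Fin.succAbove_zero]
    rw [Matrix.det_succ_column_zero, Fin.sum_univ_succ]
    rw [Finset.sum_eq_zero]
    · have h3 : (((Bmat (n+2)).submatrix Fin.succ (Fin.succAbove 1)).submatrix
          (Fin.succAbove 0) Fin.succ) = Bmat n := by
        ext i j
        simp [Bmat, a1]
      rw [h3]
      simp [Bmat, a0]
    · intro i _
      simp [Bmat, a0, Fin.ext_iff]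
  rw [Matrix.det_succ_row_zero, Fin.sum_univ_succ, Fin.sum_univ_succ, Finset.sum_eq_zero]
  · have e : (Fin.succ (0 : Fin (n+1))) = 1 := rfl
    rw [e, h2, Fin.succAbove_zero, h1]
    simp [Bmat]
    ring
  · intro i _
    simp [Bmat, Fin.ext_iff]

lemma Bmat_det (l t : ℝ) (h1 : l + t = 3) (h2 : l * t = 1) (n : ℕ) :
    (l - t) * (Bmat n).det = l^(n+1) - t^(n+1) ∧
    (l - t) * (Bmat (n+1)).det = l^(n+2) - t^(n+2) := by
  induction n with
  | zero =>
    constructor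
    · simp
    · simp [Bmat]
      rw [← h1]; ring
  | succ n ih =>
    refine ⟨ih.2, ?_⟩
    rw [Bmat_rec, mul_sub, mul_left_comm, ih.1, ih.2, ← h1]
    linear_combination (l^(n+1) - t^(n+1)) * h2

def Mmat (t : ℝ) (n : ℕ) : Matrix (Fin (n+3)) (Fin (n+3)) ℝ :=
  Matrix.of fun i j => (if i = j then 1 else 0) - t * (if i = j + 1 then 1 else 0)

lemma Mmat_det (t : ℝ) (n : ℕ) : (Mmat t n).det = 1 - t^(n+3) := by
  have hl : (Fin.last (n+1)).succ + 1 = (0 : Fin (n+3)) := by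
    simp
  have hs : ∀ i : Fin (n+2), i.castSucc + 1 = i.succ := fun i => by simp
  have d1 : ((Mmat t n).submatrix Fin.succ Fin.succ).det = 1 := by
    rw [Matrix.det_of_isLowerTriangular]
    · apply Finset.prod_eq_one
      intro i _
      simp [Mmat]
    · intro i j hij
      have hij : i < j := hij
      simp only [Mmat, Matrix.submatrix_apply, Matrix.of_apply]
      have : ¬ (i.succ = j.succ) := by simpa using hij.ne
      have h2 : ¬ (i.succ = j.succ + 1) := by
        rw [← hs]
        intro h
        have := add_right_cancel h
        simp [Fin.ext_iff] at this
        omega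
      simp [this, h2]
  have d2 : ((Mmat t n).submatrix Fin.succ Fin.castSucc).det = (-t)^(n+2) := by
    rw [Matrix.det_of_isUpperTriangular]
    · have : ∀ i, ((Mmat t n).submatrix Fin.succ Fin.castSucc) i i = -t := by
        intro i
        have : ¬ (i.succ = i.castSucc) := by simp [Fin.ext_iff]
        simp [Mmat, this]
      rw [Finset.prod_congr rfl (fun i _ => this i)]
      simp
    · intro i j hij
      have hij : j < i := hij
      simp only [Mmat, Matrix.submatrix_apply, Matrix.of_apply, hs]
      have h1 : ¬ (i.succ = j.castSucc) := by
        simp [Fin.ext_iff]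
        omega
      have h2 : ¬ (i.succ = j.succ) := by simpa using hij.ne'
      simp [h1, h2]
  rw [Matrix.det_succ_row_zero, Fin.sum_univ_succ, Fin.sum_univ_castSucc, Finset.sum_eq_zero]
  · have e : (Fin.last (n+1)).succ = Fin.last (n+2) := rfl
    rw [Fin.succAbove_zero, d1, e, Fin.succAbove_last, d2]
    have h0 : ¬ ((0 : Fin (n+3)) = Fin.last (n+2)) := by simp [Fin.ext_iff]
    have h3 : Mmat t n 0 0 = 1 := by simp [Mmat]
    have h4 : Mmat t n 0 (Fin.last (n+2)) = -t := by simp [Mmat, h0]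
    rw [h3, h4]
    have : (-1:ℝ)^(n+2) * (-t)^(n+2) = t^(n+2) := by rw [← mul_pow]; simp
    simp only [Fin.val_zero, Fin.val_last]
    linear_combination (-t) * this
  · intro i _
    have : ¬ ((0 : Fin (n+3)) = i.castSucc.succ) := (Fin.succ_ne_zero _).symm
    have h2 : ¬ ((0 : Fin (n+3)) = i.castSucc.succ + 1) := by
      rw [Fin.succ_castSucc, hs]; exact (Fin.succ_ne_zero _).symm
    simp [Mmat, this, h2]

lemma Cmat_eq_s14 (l t : ℝ) (h1 : l + t = 3) (h2 : l * t = 1) (n : ℕ) :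
    Cmat (n+3) = l • (Mmat t n * (Mmat t n)ᵀ) := by
  have key : ∀ i j : Fin (n+3), (Mmat t n * (Mmat t n)ᵀ) i j =
      (if i = j then 1 else 0) - t * (if j = i + 1 then 1 else 0)
       - t * (if i = j + 1 then 1 else 0) + t^2 * (if i = j then 1 else 0) := by
    intro i j
    have a : ∀ k, Mmat t n i k * Mmat t n j k =
      (if i = k then (if j = k then 1 else 0) - t * (if j = k + 1 then 1 else 0) else 0)
      - (if k = i - 1 then t * ((if j = k then 1 else 0) - t * (if j = k + 1 then 1 else 0)) else 0) := by
      intro k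
      have : (i = k + 1) ↔ (k = i - 1) := by
        rw [eq_sub_iff_add_eq, eq_comm]
      simp only [Mmat, Matrix.of_apply, this]
      split_ifs <;> ring
    simp only [Matrix.mul_apply, Matrix.transpose_apply, a, Finset.sum_sub_distrib,
      Finset.sum_ite_eq, Finset.sum_ite_eq', Finset.mem_univ, if_true, sub_add_cancel]
    have c1 : (j = i - 1) ↔ (i = j + 1) := by rw [eq_sub_iff_add_eq, eq_comm]
    have c2 : (j = i) ↔ (i = j) := eq_comm
    simp only [c1, c2]
    ring
  ext i j
  rw [Matrix.smul_apply, key, smul_eq_mul]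
  have n1 : (1 : Fin (n+3)) ≠ 0 := by simp
  have n2 : (1 + 1 : Fin (n+3)) ≠ 0 := by
    intro h
    have := congrArg Fin.val h
    simp [Fin.val_add] at this
    rw [Nat.mod_eq_of_lt (by omega)] at this
    omega
  have cast : ∀ i : Fin (n+3), (((i : ℕ) : ZMod (n+3)) : Fin (n+3)) = i := fun i =>
    Fin.cast_val_eq_self i
  have e : Cmat (n+3) i j = if i = j then 3 else if i - j = 1 ∨ i - j = -1 then -1 else 0 := by
    have c3 : ∀ a b x y : Fin (n+3), a = x → b = y → (if i = j then (3:ℝ) else if a - b = 1 ∨ a - b = -1 then -1 else 0) = if i = j then 3 else if x - y = 1 ∨ x - y = -1 then -1 else 0 := by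
      rintro a b x y rfl rfl; rfl
    exact c3 _ _ _ _ (cast i) (cast j)
  rw [e]
  have q1 : i - j = 1 ↔ i = j + 1 := by rw [sub_eq_iff_eq_add, add_comm 1 j]
  have q2 : i - j = -1 ↔ j = i + 1 := by
    rw [← neg_inj, neg_sub, neg_neg, sub_eq_iff_eq_add, add_comm 1 i]
  simp only [q1, q2]
  by_cases hij : i = j
  · subst hij
    simp
    linear_combination -h1 - t * h2
  · by_cases ha : i = j + 1
    · have hb : ¬ (j = i + 1) := by
        intro hb
        rw [ha, add_assoc] at hb
        exact n2 (left_eq_add.mp hb)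
      simp only [hij, if_false, hb, or_false, if_pos ha]
      linear_combination h2
    · by_cases hb : j = i + 1
      · simp only [hij, if_false, ha, false_or, if_pos hb]
        linear_combination h2
      · simp [hij, ha, hb]

lemma Cmat_det (l t : ℝ) (h1 : l + t = 3) (h2 : l * t = 1) (n : ℕ) :
    (Cmat (n+3)).det = l^(n+3) * (1 - t^(n+3))^2 := by
  rw [Cmat_eq_s14 l t h1 h2, Matrix.det_smul, Matrix.det_mul, Matrix.det_transpose, Mmat_det]
  simp [sq]

theorem stmt14 :
    Filter.Tendsto
      (fun N : ℕ =>
        ((Bmat (N - 1)).det - 2 * (Bmat (N - 2)).det - 2) / (2 * (Cmat N).det))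
      Filter.atTop (nhds (1 / 2 - 1 / Real.sqrt 5)) := by
  have hs : Real.sqrt 5 ^ 2 = 5 := Real.sq_sqrt (by norm_num)
  have hs2 : 2 < Real.sqrt 5 := Real.lt_sqrt_of_sq_lt (by norm_num)
  have hs3 : Real.sqrt 5 < 3 := by nlinarith
  obtain ⟨r, hr⟩ : ∃ r, r = Real.sqrt 5 := ⟨_, rfl⟩
  rw [← hr] at hs hs2 hs3 ⊢
  obtain ⟨l, hl⟩ : ∃ l, l = (3 + r) / 2 := ⟨_, rfl⟩
  obtain ⟨t, ht⟩ : ∃ t, t = (3 - r) / 2 := ⟨_, rfl⟩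
  have h1 : l + t = 3 := by rw [hl, ht]; ring
  have h2 : l * t = 1 := by rw [hl, ht]; linear_combination -hs / 4
  have h3 : l - t = r := by rw [hl, ht]; ring
  have t0 : 0 < t := by linarith
  have t1 : t < 1 := by linarith
  have l0 : 0 < l := by linarith
  have r0 : r ≠ 0 := by linarith
  have hlim : Filter.Tendsto (fun N : ℕ => t ^ N) Filter.atTop (nhds 0) :=
    tendsto_pow_atTop_nhds_zero_of_lt_one t0.le t1
  have hf : ContinuousAt (fun s : ℝ => ((1 - s^2) / r - 2 * (t - l * s^2) / r - 2 * s) /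
      (2 * (1 - s)^2)) 0 := by
    apply ContinuousAt.div
    · fun_prop
    · fun_prop
    · norm_num
  have hc := hf.tendsto.comp hlim
  have hv : ((1 - (0:ℝ)^2) / r - 2 * (t - l * 0^2) / r - 2 * 0) /
      (2 * (1 - 0)^2) = 1 / 2 - 1 / r := by
    rw [ht]; field_simp; ring
  rw [hv] at hc
  refine hc.congr' ?_
  filter_upwards [Filter.eventually_ge_atTop 3] with N hN
  obtain ⟨n, rfl⟩ := Nat.exists_eq_add_of_le' hN
  have b := Bmat_det l t h1 h2 (n+1)
  rw [h3] at b
  have e1 : n + 3 - 1 = n + 1 + 1 := by omega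
  have e2 : n + 3 - 2 = n + 1 := by omega
  rw [e1, e2, Cmat_det l t h1 h2]
  have b1 : (Bmat (n+1)).det = (l^(n+2) - t^(n+2)) / r := by
    rw [eq_div_iff r0, mul_comm]; exact b.1
  have b2 : (Bmat (n+1+1)).det = (l^(n+3) - t^(n+3)) / r := by
    rw [eq_div_iff r0, mul_comm]; exact b.2
  rw [b1, b2]
  have hp : l^(n+3) ≠ 0 := pow_ne_zero _ l0.ne'
  have hq : l^(n+3) * t^(n+3) = 1 := by rw [← mul_pow, h2, one_pow]
  have hq1 : l^(n+2) = l^(n+3) * t := by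
    linear_combination -l^(n+2) * h2
  have hq2 : t^(n+2) = t^(n+3) * l := by
    linear_combination -t^(n+2) * h2
  simp only [Function.comp_apply]
  rw [hq1, hq2]
  generalize l^(n+3) = p at *
  generalize t^(n+3) = s at *
  rw [← mul_div_mul_left _ _ hp]
  congr 1
  · field_simp
    linear_combination (-s + 2 * l * s - 2 * r) * hq
  · ring
end
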